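/- arXiv:2402.16292 — 4 statements merged into one kernel-verified Lean document; each statement's English description precedes it below -/
import Mathlib

section
/- Define ρ : PΠ_n → ℕ by ρ(∅) = 0 and ρ(π) = |⋃π| + (number of blocks of π) − 1 for π ≠ ∅. Then ρ is a rank function for the order on PΠ_n: the empty partial set partition is the least element with ρ(∅) = 0, and whenever π covers τ in PΠ_n (i.e., τ < π and no σ satisfies τ < σ < π), one has ρ(π) = ρ(τ) + 1. -/
/-- A partial set partition of `Fin n`: a finite set of nonempty, pairwise disjoint
subsets of `Fin n`, called its blocks. -/
structure PartialSetPartition (n : ℕ) where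
  blocks : Finset (Finset (Fin n))
  nonempty_of_mem : ∀ B ∈ blocks, B.Nonempty
  disjoint_of_ne : ∀ B ∈ blocks, ∀ B' ∈ blocks, B ≠ B' → Disjoint B B'

namespace PartialSetPartition

variable {n : ℕ}

/-- The ground set `|π|` of a partial set partition: the union of its blocks. -/
def ground (π : PartialSetPartition n) : Finset (Fin n) := π.blocks.sup id

/-- The order on `PΠ_n`: `τ ≤ π` iff `|τ| ⊆ |π|` and every nonempty set of the form
`P ∩ |τ|`, with `P` a block of `π`, is contained in some block of `τ`. -/
def Le (τ π : PartialSetPartition n) : Prop :=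
  τ.ground ⊆ π.ground ∧
    ∀ P ∈ π.blocks, (P ∩ τ.ground).Nonempty → ∃ B ∈ τ.blocks, P ∩ τ.ground ⊆ B

/-- The strict order on `PΠ_n`. -/
def Lt (τ π : PartialSetPartition n) : Prop := Le τ π ∧ ¬ Le π τ

/-- `π` covers `τ`: `τ < π` and no `σ` satisfies `τ < σ < π`. -/
def Covers (τ π : PartialSetPartition n) : Prop :=
  Lt τ π ∧ ¬ ∃ σ : PartialSetPartition n, Lt τ σ ∧ Lt σ π

/-- The empty partial set partition. -/
def empty (n : ℕ) : PartialSetPartition n :=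
  ⟨∅, by simp, by simp⟩

/-- The rank function `ρ`: `ρ(∅) = 0` and `ρ(π) = |⋃ π| + (#blocks of π) − 1` for
nonempty `π`. -/
def rho (π : PartialSetPartition n) : ℕ :=
  if π.blocks = ∅ then 0 else π.ground.card + π.blocks.card - 1

end PartialSetPartition

namespace PartialSetPartition

variable {n : ℕ}

theorem mem_ground {π : PartialSetPartition n} {x : Fin n} :
    x ∈ π.ground ↔ ∃ B ∈ π.blocks, x ∈ B := by
  simp [ground, Finset.mem_sup]

theorem eq_of_mem {π : PartialSetPartition n} {B C : Finset (Fin n)} (hB : B ∈ π.blocks)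
    (hC : C ∈ π.blocks) {x : Fin n} (hxB : x ∈ B) (hxC : x ∈ C) : B = C := by
  by_contra h
  exact Finset.disjoint_left.1 (π.disjoint_of_ne B hB C hC h) hxB hxC

/-- The order in terms of elements: elements of `|τ|` sharing a block of `π` share a block
of `τ`. -/
theorem le_iff {τ π : PartialSetPartition n} :
    Le τ π ↔ τ.ground ⊆ π.ground ∧ ∀ P ∈ π.blocks, ∀ x ∈ P, ∀ y ∈ P, x ∈ τ.ground →
      y ∈ τ.ground → ∃ B ∈ τ.blocks, x ∈ B ∧ y ∈ B := by
  refine and_congr_right fun _ => ⟨fun h P hP x hx y hy hxτ hyτ => ?_, fun h P hP hne => ?_⟩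
  · obtain ⟨B, hB, hPB⟩ := h P hP ⟨x, Finset.mem_inter.2 ⟨hx, hxτ⟩⟩
    exact ⟨B, hB, hPB (Finset.mem_inter.2 ⟨hx, hxτ⟩), hPB (Finset.mem_inter.2 ⟨hy, hyτ⟩)⟩
  · obtain ⟨x, hx⟩ := hne
    obtain ⟨hxP, hxτ⟩ := Finset.mem_inter.1 hx
    obtain ⟨B, hB, hxB⟩ := mem_ground.1 hxτ
    refine ⟨B, hB, fun y hy => ?_⟩
    obtain ⟨hyP, hyτ⟩ := Finset.mem_inter.1 hy
    obtain ⟨C, hC, hxC, hyC⟩ := h P hP x hxP y hyP hxτ hyτ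
    rwa [eq_of_mem hB hC hxB hxC]

theorem empty_le (π : PartialSetPartition n) : Le (empty n) π := by
  simp [Le, ground, empty]

theorem blocks_subset_of_le_of_le {τ π : PartialSetPartition n} (h₁ : Le τ π) (h₂ : Le π τ) :
    τ.blocks ⊆ π.blocks := by
  intro B hB
  rw [le_iff] at h₁ h₂
  obtain ⟨x, hx⟩ := τ.nonempty_of_mem B hB
  obtain ⟨P, hP, hxP⟩ := mem_ground.1 (h₁.1 (mem_ground.2 ⟨B, hB, hx⟩))
  have hBP : B = P := by
    ext y
    constructor
    · intro hy
      obtain ⟨Q, hQ, hxQ, hyQ⟩ := h₂.2 B hB x hx y hy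
        (h₁.1 (mem_ground.2 ⟨B, hB, hx⟩)) (h₁.1 (mem_ground.2 ⟨B, hB, hy⟩))
      rwa [eq_of_mem hP hQ hxP hxQ]
    · intro hy
      obtain ⟨C, hC, hxC, hyC⟩ := h₁.2 P hP x hxP y hy
        (h₂.1 (mem_ground.2 ⟨P, hP, hxP⟩)) (h₂.1 (mem_ground.2 ⟨P, hP, hy⟩))
      rwa [eq_of_mem hB hC hx hxC]
  rwa [hBP]

theorem le_antisymm {τ π : PartialSetPartition n} (h₁ : Le τ π) (h₂ : Le π τ) : τ = π := by
  have h := (blocks_subset_of_le_of_le h₁ h₂).antisymm (blocks_subset_of_le_of_le h₂ h₁)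
  cases τ
  cases π
  simpa using h

/-- The partial set partition whose only block is `{x}`. -/
def single (x : Fin n) : PartialSetPartition n :=
  ⟨{{x}}, by simp, by simp⟩

/-- Adjoin a new element `x` to the block `B`. -/
def adjoin (τ : PartialSetPartition n) (B : Finset (Fin n)) (hB : B ∈ τ.blocks) (x : Fin n)
    (hx : x ∉ τ.ground) : PartialSetPartition n where
  blocks := insert (insert x B) (τ.blocks.erase B)
  nonempty_of_mem := by
    have := τ.nonempty_of_mem
    simp only [Finset.mem_insert, Finset.mem_erase]
    rintro C (rfl | hC)
    · simp
    · exact this C hC.2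
  disjoint_of_ne := by
    have := @eq_of_mem n τ
    simp only [mem_ground] at hx
    simp only [Finset.mem_insert, Finset.mem_erase, Finset.disjoint_left]
    grind

/-- Split the block `B` into `P` and `B \ P`. -/
def split (τ : PartialSetPartition n) (B : Finset (Fin n)) (hB : B ∈ τ.blocks)
    (P : Finset (Fin n)) (hP : P.Nonempty) (hPB : P ⊂ B) : PartialSetPartition n where
  blocks := insert P (insert (B \ P) (τ.blocks.erase B))
  nonempty_of_mem := by
    have := τ.nonempty_of_mem
    simp only [Finset.mem_insert, Finset.mem_erase]
    rintro C (rfl | rfl | hC)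
    · exact hP
    · exact Finset.sdiff_nonempty.2 hPB.2
    · exact this C hC.2
  disjoint_of_ne := by
    have := @eq_of_mem n τ
    have := hPB.1
    simp only [Finset.mem_insert, Finset.mem_erase, Finset.disjoint_left]
    grind

theorem ground_single (x : Fin n) : (single x).ground = {x} := by
  simp [ground, single]

theorem ground_adjoin (τ : PartialSetPartition n) (B : Finset (Fin n)) (hB : B ∈ τ.blocks)
    (x : Fin n) (hx : x ∉ τ.ground) : (τ.adjoin B hB x hx).ground = insert x τ.ground := by
  ext y
  simp only [mem_ground, adjoin, Finset.mem_insert, Finset.mem_erase]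
  grind

theorem ground_split (τ : PartialSetPartition n) (B : Finset (Fin n)) (hB : B ∈ τ.blocks)
    (P : Finset (Fin n)) (hP : P.Nonempty) (hPB : P ⊂ B) :
    (τ.split B hB P hP hPB).ground = τ.ground := by
  have := hPB.1
  ext y
  simp only [mem_ground, split, Finset.mem_insert, Finset.mem_erase]
  grind

theorem rho_empty : rho (empty n) = 0 := by
  simp [rho, empty]

theorem rho_single (x : Fin n) : rho (single x) = 1 := by
  rw [rho, ground_single]
  simp [single]

theorem rho_of_mem {π : PartialSetPartition n} {B : Finset (Fin n)} (hB : B ∈ π.blocks) :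
    rho π = π.ground.card + π.blocks.card - 1 :=
  if_neg (Finset.ne_empty_of_mem hB)

theorem rho_adjoin (τ : PartialSetPartition n) (B : Finset (Fin n)) (hB : B ∈ τ.blocks)
    (x : Fin n) (hx : x ∉ τ.ground) : rho (τ.adjoin B hB x hx) = rho τ + 1 := by
  have hnew : insert x B ∉ τ.blocks.erase B := fun h =>
    hx (mem_ground.2 ⟨_, Finset.mem_of_mem_erase h, Finset.mem_insert_self x B⟩)
  have hpos : 0 < τ.blocks.card := Finset.card_pos.2 ⟨B, hB⟩
  rw [rho_of_mem hB, rho_of_mem (B := insert x B) (by simp [adjoin]), ground_adjoin,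
    Finset.card_insert_of_notMem hx]
  simp only [adjoin]
  rw [Finset.card_insert_of_notMem hnew, Finset.card_erase_of_mem hB]
  omega

theorem rho_split (τ : PartialSetPartition n) (B : Finset (Fin n)) (hB : B ∈ τ.blocks)
    (P : Finset (Fin n)) (hP : P.Nonempty) (hPB : P ⊂ B) :
    rho (τ.split B hB P hP hPB) = rho τ + 1 := by
  have hpos : 0 < τ.blocks.card := Finset.card_pos.2 ⟨B, hB⟩
  have hsub := hPB.1
  have hne := Finset.sdiff_nonempty.2 hPB.2
  have heq := @eq_of_mem n τ
  have h₁ : B \ P ∉ τ.blocks.erase B := by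
    intro h
    obtain ⟨y, hy⟩ := hne
    exact (Finset.mem_erase.1 h).1
      (heq (Finset.mem_of_mem_erase h) hB hy (Finset.mem_sdiff.1 hy).1)
  have h₂ : P ∉ insert (B \ P) (τ.blocks.erase B) := by
    intro h
    obtain ⟨y, hy⟩ := hP
    rcases Finset.mem_insert.1 h with h | h
    · rw [h] at hy
      grind
    · exact (Finset.mem_erase.1 h).1 (heq (Finset.mem_of_mem_erase h) hB hy (hsub hy))
  rw [rho_of_mem hB, rho_of_mem (B := P) (by simp [split]), ground_split]
  simp only [split]
  rw [Finset.card_insert_of_notMem h₂, Finset.card_insert_of_notMem h₁,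
    Finset.card_erase_of_mem hB]
  omega

theorem single_le {π : PartialSetPartition n} {x : Fin n} (hx : x ∈ π.ground) :
    Le (single x) π := by
  rw [le_iff, ground_single]
  simp +contextual [single, hx]

theorem lt_adjoin (τ : PartialSetPartition n) (B : Finset (Fin n)) (hB : B ∈ τ.blocks)
    (x : Fin n) (hx : x ∉ τ.ground) : Lt τ (τ.adjoin B hB x hx) := by
  constructor
  · rw [le_iff, ground_adjoin]
    refine ⟨Finset.subset_insert _ _, ?_⟩
    simp only [adjoin, Finset.mem_insert, Finset.mem_erase]
    grind
  · intro h
    have := h.1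
    rw [ground_adjoin] at this
    exact hx (this (Finset.mem_insert_self _ _))

theorem lt_split (τ : PartialSetPartition n) (B : Finset (Fin n)) (hB : B ∈ τ.blocks)
    (P : Finset (Fin n)) (hP : P.Nonempty) (hPB : P ⊂ B) : Lt τ (τ.split B hB P hP hPB) := by
  have hle : Le τ (τ.split B hB P hP hPB) := by
    have := hPB.1
    rw [le_iff, ground_split]
    refine ⟨subset_rfl, ?_⟩
    simp only [split, Finset.mem_insert, Finset.mem_erase]
    grind
  refine ⟨hle, fun h => ?_⟩
  have h₁ := rho_split τ B hB P hP hPB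
  rw [← le_antisymm hle h] at h₁
  omega

theorem adjoin_le {τ π : PartialSetPartition n} (h : Le τ π) {B P : Finset (Fin n)}
    (hB : B ∈ τ.blocks) {x : Fin n} (hx : x ∉ τ.ground) (hP : P ∈ π.blocks) (hxP : x ∈ P)
    (hPB : P ∩ τ.ground ⊆ B) : Le (τ.adjoin B hB x hx) π := by
  rw [le_iff] at h ⊢
  rw [ground_adjoin]
  refine ⟨Finset.insert_subset (mem_ground.2 ⟨P, hP, hxP⟩) h.1, fun Q hQ y hy z hz hy' hz' => ?_⟩
  by_cases hxQ : x ∈ Q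
  · obtain rfl := eq_of_mem hP hQ hxP hxQ
    refine ⟨insert x B, by simp [adjoin], ?_⟩
    grind
  · obtain ⟨C, hC, hyC, hzC⟩ := h.2 Q hQ y hy z hz (by grind) (by grind)
    by_cases hCB : C = B
    · exact ⟨insert x B, by simp [adjoin], by grind⟩
    · exact ⟨C, by simp [adjoin, hC, hCB], hyC, hzC⟩

theorem split_le {τ π : PartialSetPartition n} (h : Le τ π) {B P : Finset (Fin n)}
    (hB : B ∈ τ.blocks) (hP : P ∈ π.blocks) (hPB : P ⊂ B) :
    Le (τ.split B hB P (π.nonempty_of_mem P hP) hPB) π := by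
  rw [le_iff] at h ⊢
  rw [ground_split]
  refine ⟨h.1, fun Q hQ y hy z hz hy' hz' => ?_⟩
  obtain ⟨C, hC, hyC, hzC⟩ := h.2 Q hQ y hy z hz hy' hz'
  by_cases hCB : C = B
  · subst hCB
    by_cases hQP : Q = P
    · exact ⟨P, by simp [split], hQP ▸ hy, hQP ▸ hz⟩
    · have hd := Finset.disjoint_left.1 (π.disjoint_of_ne Q hQ P hP hQP)
      exact ⟨C \ P, by simp [split], Finset.mem_sdiff.2 ⟨hyC, hd hy⟩,
        Finset.mem_sdiff.2 ⟨hzC, hd hz⟩⟩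
  · exact ⟨C, by simp [split, hC, hCB], hyC, hzC⟩

/-- Below any `π > τ` there is an element above `τ` of rank one more. -/
theorem exists_lt_le_rho_eq {τ π : PartialSetPartition n} (h : Lt τ π) :
    ∃ σ, Lt τ σ ∧ Le σ π ∧ rho σ = rho τ + 1 := by
  obtain ⟨hle, hnle⟩ := h
  rcases τ.blocks.eq_empty_or_nonempty with hτ | ⟨B₀, hB₀⟩
  · obtain rfl : τ = empty n := by
      cases τ
      simpa [empty] using hτ
    have hne : π.ground.Nonempty := by
      rw [Finset.nonempty_iff_ne_empty]
      intro h0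
      exact hnle (by simp [Le, h0])
    obtain ⟨x, hx⟩ := hne
    refine ⟨single x, ⟨empty_le _, fun h => ?_⟩, single_le hx, by rw [rho_single, rho_empty]⟩
    have := h.1
    simp [ground, empty, single] at this
  by_cases hsub : π.ground ⊆ τ.ground
  · have hg : τ.ground = π.ground := hle.1.antisymm hsub
    simp only [Le, hsub, true_and, not_forall, not_exists, not_and] at hnle
    obtain ⟨B, hB, ⟨x, hx⟩, hBn⟩ := hnle
    obtain ⟨hxB, hxπ⟩ := Finset.mem_inter.1 hx
    obtain ⟨P, hP, hxP⟩ := mem_ground.1 hxπ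
    have hPB : P ⊂ B := by
      refine ⟨fun y hy => ?_, fun hBP => hBn P hP (Finset.inter_subset_left.trans hBP)⟩
      obtain ⟨C, hC, hxC, hyC⟩ := (le_iff.1 hle).2 P hP x hxP y hy
        (hsub hxπ) (hsub (mem_ground.2 ⟨P, hP, hy⟩))
      rwa [eq_of_mem hB hC hxB hxC]
    exact ⟨_, lt_split τ B hB P (π.nonempty_of_mem P hP) hPB, split_le hle hB hP hPB,
      rho_split ..⟩
  · obtain ⟨x, hxπ, hx⟩ := Finset.not_subset.1 hsub
    obtain ⟨P, hP, hxP⟩ := mem_ground.1 hxπ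
    obtain ⟨B, hB, hPB⟩ : ∃ B ∈ τ.blocks, P ∩ τ.ground ⊆ B := by
      rcases (P ∩ τ.ground).eq_empty_or_nonempty with h0 | h0
      · exact ⟨B₀, hB₀, by simp [h0]⟩
      · exact hle.2 P hP h0
    exact ⟨_, lt_adjoin τ B hB x hx, adjoin_le hle hB hx hP hxP hPB, rho_adjoin ..⟩

end PartialSetPartition

open PartialSetPartition in
/-- `ρ` is a rank function for the order on `PΠ_n`: the empty partial set partition is
the least element, `ρ(∅) = 0`, and `ρ` increases by exactly `1` along covering
relations. -/
theorem rho_is_rank_function (n : ℕ) :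
    (∀ π : PartialSetPartition n, Le (empty n) π) ∧
      rho (empty n) = 0 ∧
      ∀ τ π : PartialSetPartition n, Covers τ π → rho π = rho τ + 1 := by
  refine ⟨empty_le, rho_empty, fun τ π ⟨hlt, hcov⟩ => ?_⟩
  obtain ⟨σ, hτσ, hσπ, hρ⟩ := exists_lt_le_rho_eq hlt
  have hπσ : Le π σ := by
    by_contra h
    exact hcov ⟨σ, hτσ, hσπ, h⟩
  rw [← hρ, le_antisymm hπσ hσπ]
end

section
/- In PΠ_4, the elements π = {{1},{2}} and τ = {{3},{4}} have no least upper bound: both σ₁ = {{1,3},{2,4}} and σ₂ = {{1,4},{2,3}} are upper bounds of {π, τ}, but there is no γ ∈ PΠ_4 with π ≤ γ and τ ≤ γ such that γ ≤ δ for every upper bound δ of {π, τ}. In particular, PΠ_4 with this order is not a lattice. -/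
open PartialSetPartition

/-- `π = {{1},{2}}` (as an element of `PΠ_4`, with the four elements of the ground set
`Fin 4` written `0,1,2,3`). -/
def pi₀ : PartialSetPartition 4 := ⟨{{0}, {1}}, by decide, by decide⟩

/-- `τ = {{3},{4}}`. -/
def tau₀ : PartialSetPartition 4 := ⟨{{2}, {3}}, by decide, by decide⟩

/-- `σ₁ = {{1,3},{2,4}}`. -/
def sigma₁ : PartialSetPartition 4 := ⟨{{0, 2}, {1, 3}}, by decide, by decide⟩

/-- `σ₂ = {{1,4},{2,3}}`. -/
def sigma₂ : PartialSetPartition 4 := ⟨{{0, 3}, {1, 2}}, by decide, by decide⟩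

namespace PartialSetPartition

/-- If `τ ≤ π`, elements of `|τ|` sharing a block of `π` share a block of `τ`. -/
theorem Le.exists_common_block {n : ℕ} {τ π : PartialSetPartition n} (h : Le τ π)
    {P : Finset (Fin n)} (hP : P ∈ π.blocks) {a b : Fin n} (ha : a ∈ P) (hb : b ∈ P)
    (haτ : a ∈ τ.ground) (hbτ : b ∈ τ.ground) : ∃ B ∈ τ.blocks, a ∈ B ∧ b ∈ B := by
  have ha' := Finset.mem_inter.2 ⟨ha, haτ⟩
  have hb' := Finset.mem_inter.2 ⟨hb, hbτ⟩
  obtain ⟨B, hB, hsub⟩ := h.2 P hP ⟨a, ha'⟩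
  exact ⟨B, hB, hsub ha', hsub hb'⟩

/-- Blocks with a common element are equal. -/
theorem eq_of_mem_of_mem {n : ℕ} (π : PartialSetPartition n) {B B' : Finset (Fin n)}
    (hB : B ∈ π.blocks) (hB' : B' ∈ π.blocks) {a : Fin n} (ha : a ∈ B) (ha' : a ∈ B') :
    B = B' := by
  by_contra hne
  exact Finset.disjoint_left.1 (π.disjoint_of_ne B hB B' hB' hne) ha ha'

end PartialSetPartition

/-- In `PΠ_4`, the elements `π = {{1},{2}}` and `τ = {{3},{4}}` have no least upper
bound: both `σ₁ = {{1,3},{2,4}}` and `σ₂ = {{1,4},{2,3}}` are upper bounds of `{π, τ}`,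
but no `γ` is an upper bound of `{π, τ}` lying below every upper bound of `{π, τ}`.
In particular, `PΠ_4` is not a lattice. -/
theorem no_least_upper_bound :
    (Le pi₀ sigma₁ ∧ Le tau₀ sigma₁) ∧ (Le pi₀ sigma₂ ∧ Le tau₀ sigma₂) ∧
      ¬ ∃ γ : PartialSetPartition 4, Le pi₀ γ ∧ Le tau₀ γ ∧
          ∀ δ : PartialSetPartition 4, Le pi₀ δ → Le tau₀ δ → Le γ δ := by
  have h₁ : Le pi₀ sigma₁ ∧ Le tau₀ sigma₁ := by unfold Le; decide
  have h₂ : Le pi₀ sigma₂ ∧ Le tau₀ sigma₂ := by unfold Le; decide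
  refine ⟨h₁, h₂, ?_⟩
  rintro ⟨γ, hπ, hτ, hγ⟩
  have m0 : 0 ∈ γ.ground := hπ.1 (by decide)
  have m2 : 2 ∈ γ.ground := hτ.1 (by decide)
  have m3 : 3 ∈ γ.ground := hτ.1 (by decide)
  obtain ⟨B, hB, hB0, hB2⟩ := (hγ sigma₁ h₁.1 h₁.2).exists_common_block
    (P := {0, 2}) (by decide) (by decide) (by decide) m0 m2
  obtain ⟨C, hC, hC0, hC3⟩ := (hγ sigma₂ h₂.1 h₂.2).exists_common_block
    (P := {0, 3}) (by decide) (by decide) (by decide) m0 m3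
  obtain rfl := γ.eq_of_mem_of_mem hB hC hB0 hC0
  have separated : ¬ ∃ D ∈ tau₀.blocks, 2 ∈ D ∧ 3 ∈ D := by decide
  exact separated (hτ.exists_common_block hB hB2 hC3 (by decide) (by decide))
end

section
/- Let C ⊆ PΠ_{n,2} be a split closed order ideal, and suppose γ assigns to each disconnected set D ⊆ Fin n an element γ_D ∈ C with |γ_D| = D that is greatest among elements of C with ground set D (σ ≤ γ_D for every σ ∈ C with |σ| = D). In the polynomial ring ℝ[q_S : S ⊆ Fin n] (the multivariate polynomial ring MvPolynomial over the type of subsets of Fin n), the ideal J_C generated by the binomials q_D − ∏_{B block of γ_D} q_B, for all disconnected D, is a prime ideal. -/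
namespace PartialSetPartition

variable {n : ℕ}

/-- Membership in `PΠ_{n,2}`: at least two blocks. -/
def TwoBlocks (π : PartialSetPartition n) : Prop := 2 ≤ π.blocks.card

/-- `ρ` is the splitting `π^τ` of `π` by the two-block partial set partition `τ`:
some block `B` of `π` equals the union of the two blocks of `τ` (i.e. `|τ|`), and `ρ` is
obtained from `π` by replacing `B` with the two blocks of `τ`. -/
def IsSplitting (π τ ρ : PartialSetPartition n) : Prop :=
  τ.blocks.card = 2 ∧
    ∃ B ∈ π.blocks, B = τ.ground ∧ ρ.blocks = (π.blocks.erase B) ∪ τ.blocks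

/-- A split closed order ideal: a subset of `PΠ_{n,2}` that is downward closed for the
order on `PΠ_n` and closed under splittings. -/
def IsSplitClosedIdeal (C : Set (PartialSetPartition n)) : Prop :=
  (∀ π ∈ C, TwoBlocks π) ∧
    (∀ π ∈ C, ∀ τ, TwoBlocks τ → Le τ π → τ ∈ C) ∧
    (∀ π ∈ C, ∀ τ ∈ C, ∀ ρ, IsSplitting π τ ρ → ρ ∈ C)

end PartialSetPartition

namespace PartialSetPartition

/-- A nonempty set `D` is disconnected with respect to `C` if `D` is the ground set of
some element of `C`. -/
def Disconnected {n : ℕ} (C : Set (PartialSetPartition n)) (D : Finset (Fin n)) : Prop :=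
  ∃ π ∈ C, π.ground = D

end PartialSetPartition

open MvPolynomial in
/-- A binomial ideal generated by relations `X i - ∏ j ∈ b i, X j`, one for each `i ∈ s`, is prime
as soon as the variables in `b i` precede `i` in a well-founded relation: recursive substitution
identifies it with the kernel of an endomorphism of the polynomial ring. -/
theorem MvPolynomial.isPrime_span_X_sub_prod_of_wellFounded {ι R : Type*} [CommRing R] [IsDomain R]
    {r : ι → ι → Prop} (hr : WellFounded r) (s : Set ι) (b : ι → Finset ι)
    (hb : ∀ i ∈ s, ∀ j ∈ b i, r j i) :
    (Ideal.span {f : MvPolynomial ι R | ∃ i, i ∈ s ∧ f = X i - ∏ j ∈ b i, X j}).IsPrime := by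
  classical
  set J := Ideal.span {f : MvPolynomial ι R | ∃ i, i ∈ s ∧ f = X i - ∏ j ∈ b i, X j} with hJ
  obtain ⟨g, hg_mem, hg_not_mem⟩ : ∃ g : ι → MvPolynomial ι R,
      (∀ i ∈ s, g i = ∏ j ∈ b i, g j) ∧ ∀ i ∉ s, g i = X i := by
    let F : ∀ i, (∀ j, r j i → MvPolynomial ι R) → MvPolynomial ι R := fun i ih ↦
      if hi : i ∈ s then ∏ j ∈ (b i).attach, ih j (hb i hi j j.2) else X i
    refine ⟨hr.fix F, fun i hi ↦ ?_, fun i hi ↦ ?_⟩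
    · rw [hr.fix_eq]
      simp only [F, dif_pos hi]
      exact Finset.prod_attach (b i) (fun j ↦ hr.fix F j)
    · rw [hr.fix_eq]
      simp only [F, dif_neg hi]
  have mk_g : ∀ i, Ideal.Quotient.mk J (g i) = Ideal.Quotient.mk J (X i) := by
    intro i
    induction i using hr.induction with
    | _ i ih =>
      by_cases hi : i ∈ s
      · have hmem : X i - ∏ j ∈ b i, X j ∈ J := Ideal.subset_span ⟨i, hi, rfl⟩
        rw [Ideal.Quotient.eq.2 hmem, hg_mem i hi, map_prod, map_prod]
        exact Finset.prod_congr rfl fun j hj ↦ ih j (hb i hi j hj)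
      · rw [hg_not_mem i hi]
  have mk_aeval : ∀ p, Ideal.Quotient.mk J (aeval g p) = Ideal.Quotient.mk J p := by
    intro p
    have : (Ideal.Quotient.mkₐ R J).comp (aeval g) = Ideal.Quotient.mkₐ R J := by
      ext i
      simpa using mk_g i
    exact DFunLike.congr_fun this p
  have hker : J = RingHom.ker (aeval g : MvPolynomial ι R →ₐ[R] MvPolynomial ι R) := by
    apply le_antisymm
    · rw [hJ, Ideal.span_le]
      rintro _ ⟨i, hi, rfl⟩
      simp [RingHom.mem_ker, ← hg_mem i hi]
    · intro p hp
      rw [RingHom.mem_ker] at hp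
      rw [← Ideal.Quotient.eq_zero_iff_mem, ← mk_aeval, hp, map_zero]
  rw [hker]
  exact RingHom.ker_isPrime _

/-- A block of a partial set partition with at least two blocks is a proper subset of the
ground set. -/
theorem PartialSetPartition.TwoBlocks.ssubset_ground {n : ℕ} {π : PartialSetPartition n}
    (hπ : π.TwoBlocks) {B : Finset (Fin n)} (hB : B ∈ π.blocks) : B ⊂ π.ground := by
  have hle : ∀ B ∈ π.blocks, B ⊆ π.ground := fun B hB ↦ Finset.le_sup (f := id) hB
  obtain ⟨B', hB', hne⟩ := Finset.exists_mem_ne hπ B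
  obtain ⟨x, hx⟩ := π.nonempty_of_mem B' hB'
  refine Finset.ssubset_iff_subset_ne.2 ⟨hle B hB, fun h ↦ ?_⟩
  exact Finset.disjoint_left.1 (π.disjoint_of_ne B' hB' B hB hne) hx (h ▸ hle B' hB' hx)

open PartialSetPartition MvPolynomial in
/-- Let `C` be a split closed order ideal and suppose `γ` assigns to each disconnected
set `D` a greatest element of `C` with ground set `D`.  Then the inhomogeneous marginal
independence ideal `J_C ⊆ ℝ[q_S : S ⊆ Fin n]`, generated by the binomials
`q_D − ∏_{B block of γ_D} q_B` over all disconnected `D`, is prime. -/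
theorem marginalIndependenceIdeal_isPrime
    {n : ℕ} (C : Set (PartialSetPartition n)) (hC : IsSplitClosedIdeal C)
    (γ : Finset (Fin n) → PartialSetPartition n)
    (hγ : ∀ D : Finset (Fin n), Disconnected C D →
      γ D ∈ C ∧ (γ D).ground = D ∧ ∀ σ ∈ C, σ.ground = D → Le σ (γ D)) :
    (Ideal.span {f : MvPolynomial (Finset (Fin n)) ℝ |
        ∃ D : Finset (Fin n), Disconnected C D ∧
          f = X D - ∏ B ∈ (γ D).blocks, X B}).IsPrime := by
  refine isPrime_span_X_sub_prod_of_wellFounded (r := (· ⊂ ·)) wellFounded_lt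
    {D | Disconnected C D} (fun D ↦ (γ D).blocks) fun D hD B hB ↦ ?_
  obtain ⟨hmem, hground, -⟩ := hγ D hD
  exact hground ▸ (hC.1 _ hmem).ssubset_ground hB
end

section
/- Let n ∈ ℕ, r : Fin n → ℕ with r k ≥ 1 for all k, and let p : (∀ k, Fin (r k)) → ℝ. Define q : (∀ k, Fin (r k)) → ℝ by q(i) = Σ_{j ≤ i} p(j), where j ≤ i means j k ≤ i k for every k (componentwise order). Then for every index vector i, p(i) = Σ_j (−1)^{Σ_k ((i k : ℕ) − (j k : ℕ))} q(j), where the sum ranges over all j with (i k : ℕ) − (j k : ℕ) ∈ {0, 1} for every k (equivalently, j ≤ i and i − j ≤ 1 componentwise). -/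
/-- The Möbius function of a finite chain is inverse to its zeta function. -/
theorem Fin.sum_moebius_mul_zeta {m : ℕ} (a c : Fin m) :
    ∑ b : Fin m, (if b ≤ a ∧ (a : ℕ) ≤ (b : ℕ) + 1 then (-1 : ℝ) ^ ((a : ℕ) - (b : ℕ)) else 0) *
      (if c ≤ b then 1 else 0) = if c = a then 1 else 0 := by
  have key : ∀ b : Fin m,
      (if b ≤ a ∧ (a : ℕ) ≤ (b : ℕ) + 1 then (-1 : ℝ) ^ ((a : ℕ) - (b : ℕ)) else 0) =
        (if b = a then 1 else 0) - (if (b : ℕ) + 1 = a then 1 else 0) := by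
    intro b
    by_cases h₁ : b = a
    · subst h₁
      simp
    by_cases h₂ : (b : ℕ) + 1 = a
    · have hle : b ≤ a := Fin.le_def.2 (by omega)
      have hsub : (a : ℕ) - b = 1 := by omega
      simp [h₁, h₂, hle, hsub]
    · have hn : ¬ (b ≤ a ∧ (a : ℕ) ≤ (b : ℕ) + 1) := by
        rw [Fin.le_def]
        have := Fin.val_ne_of_ne h₁
        omega
      simp [h₁, h₂, hn]
  simp only [key, sub_mul, Finset.sum_sub_distrib, ite_mul, one_mul, zero_mul,
    Finset.sum_ite_eq', Finset.mem_univ, if_true]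
  rcases Nat.eq_zero_or_pos (a : ℕ) with ha | ha
  · have hz : ∀ b : Fin m, ¬ ((b : ℕ) + 1 = a) := fun b => by omega
    simp only [hz, if_false, Finset.sum_const_zero, sub_zero]
    refine if_congr ?_ rfl rfl
    rw [Fin.le_def, Fin.ext_iff]
    omega
  · have hb : ∀ b : Fin m, ((b : ℕ) + 1 = a) ↔ b = ⟨(a : ℕ) - 1, by omega⟩ := fun b => by
      rw [Fin.ext_iff]
      dsimp only
      omega
    simp only [hb, Finset.sum_ite_eq', Finset.mem_univ, if_true]
    simp only [Fin.le_def, Fin.ext_iff]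
    split_ifs <;> first | omega | norm_num


/-- Möbius inversion for the cumulative distribution transform on a product of chains:
if `q i = ∑_{j ≤ i} p j` (componentwise order), then
`p i = ∑_j (−1)^{∑ k (i k − j k)} q j`, the sum over all `j` with `j ≤ i` and
`i − j ≤ 1` componentwise. -/
theorem cdf_moebius_inversion
    {n : ℕ} (r : Fin n → ℕ) (hr : ∀ k, 1 ≤ r k)
    (p q : (∀ k, Fin (r k)) → ℝ)
    (hq : ∀ i, q i =
      ∑ j ∈ Finset.univ.filter (fun j : ∀ k, Fin (r k) => ∀ k, j k ≤ i k), p j) :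
    ∀ i, p i =
      ∑ j ∈ Finset.univ.filter
          (fun j : ∀ k, Fin (r k) => ∀ k, j k ≤ i k ∧ (i k : ℕ) ≤ (j k : ℕ) + 1),
        (-1 : ℝ) ^ (∑ k, ((i k : ℕ) - (j k : ℕ))) * q j := by
  intro i
  have weight : ∀ j : ∀ k, Fin (r k),
      (if ∀ k, j k ≤ i k ∧ (i k : ℕ) ≤ (j k : ℕ) + 1 then
        (-1 : ℝ) ^ (∑ k, ((i k : ℕ) - (j k : ℕ))) * q j else 0) =
      ∑ l, (∏ k, (if j k ≤ i k ∧ (i k : ℕ) ≤ (j k : ℕ) + 1 then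
        (-1 : ℝ) ^ ((i k : ℕ) - (j k : ℕ)) else 0) * (if l k ≤ j k then 1 else 0)) * p l := by
    intro j
    simp only [Finset.prod_mul_distrib, Finset.prod_ite_zero, Finset.prod_const_one,
      Finset.mem_univ, true_imp_iff, Finset.prod_pow_eq_pow_sum, mul_assoc]
    rw [← Finset.mul_sum, hq j, Finset.sum_filter]
    simp only [ite_mul, one_mul, zero_mul]
  rw [Finset.sum_filter, Finset.sum_congr rfl fun j _ => weight j, Finset.sum_comm]
  simp only [← Finset.sum_mul]
  have factor : ∀ l : ∀ k, Fin (r k),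
      ∑ j : ∀ k, Fin (r k), ∏ k, (if j k ≤ i k ∧ (i k : ℕ) ≤ (j k : ℕ) + 1 then
        (-1 : ℝ) ^ ((i k : ℕ) - (j k : ℕ)) else 0) * (if l k ≤ j k then 1 else 0) =
      if l = i then 1 else 0 := by
    intro l
    rw [← Fintype.piFinset_univ, ← Finset.prod_univ_sum (fun k => (Finset.univ : Finset (Fin (r k))))
      (fun k b => (if b ≤ i k ∧ (i k : ℕ) ≤ (b : ℕ) + 1 then
        (-1 : ℝ) ^ ((i k : ℕ) - (b : ℕ)) else 0) * (if l k ≤ b then 1 else 0))]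
    simp only [Fin.sum_moebius_mul_zeta, Finset.prod_ite_zero, Finset.prod_const_one,
      Finset.mem_univ, true_imp_iff, funext_iff]
  simp only [factor]
  simp only [ite_mul, one_mul, zero_mul, Finset.sum_ite_eq', Finset.mem_univ, if_true]
end
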